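/- Mixed even moments (Lemma 4, even case): for every fixed s ≥ 0 and l ≥ 0, the expectation ⟨S_{2,n}^l·(S_{2,n} − n/4)^{2s}⟩ under P_n is asymptotically equivalent, as n → ∞, to (n/4)^l·((2s−1)!!/4^{2s})·n^s. -/

import Mathlib

open MeasureTheory ProbabilityTheory Filter
open scoped NNReal Topology

/-- Binary trees: every internal node has exactly two children. -/
inductive BinTree : Type
  | leaf : BinTree
  | node : BinTree → BinTree → BinTree
  deriving DecidableEq

namespace BinTree

/-- The magnitude of a binary tree is its number of leaves. -/
def magnitude : BinTree → ℕ
  | leaf => 1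
  | node l r => magnitude l + magnitude r

/-- The Horton–Strahler order of (the root of) a binary tree:
leaves have order 1; a node whose two children have distinct orders has the max of the two;
a node whose two children have equal order `r` has order `r + 1`. -/
def ord : BinTree → ℕ
  | leaf => 1
  | node l r => if ord l = ord r then ord l + 1 else max (ord l) (ord r)

/-- `branches k τ` is `S_{k,n}(τ)`, the number of Horton–Strahler branches of order `k`
in `τ`, i.e. the number of maximal connected paths of nodes of order `k`.  It counts the
nodes of order `k` that head a branch: a new branch head of order `ord l + 1` is created
exactly at a node whose two children have equal order `ord l`, and every leaf heads an
order-1 branch. -/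
def branches (k : ℕ) : BinTree → ℕ
  | leaf => if k = 1 then 1 else 0
  | node l r => branches k l + branches k r +
      (if ord l = ord r ∧ ord l + 1 = k then 1 else 0)

end BinTree

/-- `treesOf n` is the finite set `Ω_n` of binary trees of magnitude `n`. -/
def treesOf : ℕ → Finset BinTree
  | 0 => ∅
  | 1 => {BinTree.leaf}
  | (n+2) => (Finset.range (n+1)).attach.biUnion fun k =>
      ((treesOf (k.1+1)) ×ˢ (treesOf (n+1-k.1))).image fun p => BinTree.node p.1 p.2
  decreasing_by
  · have := Finset.mem_range.mp k.2; omega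
  · omega

/-- Expectation `⟨f⟩` under the uniform probability measure `P_n` on `Ω_n` (the random model). -/
noncomputable def expect (n : ℕ) (f : BinTree → ℝ) : ℝ :=
  (∑ τ ∈ treesOf n, f τ) / (treesOf n).card

/-- The operator on power series acting by `δ n` on the `n`-th coefficient. -/
noncomputable def coeffwise {R : Type*} [CommRing R] (δ : ℕ → R → R) (F : PowerSeries R) :
    PowerSeries R :=
  PowerSeries.mk fun n => δ n (PowerSeries.coeff n F)

lemma coeffwise_mul {R : Type*} [CommRing R] (δ : ℕ → R →+ R)
    (hδ : ∀ i j a b, δ (i + j) (a * b) = δ i a * b + a * δ j b) (F G : PowerSeries R) :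
    coeffwise (fun n => δ n) (F * G)
      = coeffwise (fun n => δ n) F * G + F * coeffwise (fun n => δ n) G := by
  ext n
  simp only [coeffwise, PowerSeries.coeff_mk, map_add, PowerSeries.coeff_mul, map_sum,
    ← Finset.sum_add_distrib]
  refine Finset.sum_congr rfl fun p hp => ?_
  rw [← Finset.HasAntidiagonal.mem_antidiagonal.mp hp, hδ]

lemma coeffwise_add {R : Type*} [CommRing R] (δ : ℕ → R →+ R) (F G : PowerSeries R) :
    coeffwise (fun n => δ n) (F + G)
      = coeffwise (fun n => δ n) F + coeffwise (fun n => δ n) G := by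
  ext n
  simp [coeffwise]

/-- `n - 2 y d/dy` as an additive map on polynomials in `y`. -/
noncomputable def eulerOp (n : ℕ) : Polynomial ℝ →+ Polynomial ℝ where
  toFun p := (n : Polynomial ℝ) * p - 2 * Polynomial.X * Polynomial.derivative p
  map_zero' := by simp
  map_add' p q := by simp only [Polynomial.derivative_add]; ring

lemma eulerOp_apply (n : ℕ) (p : Polynomial ℝ) :
    eulerOp n p = (n : Polynomial ℝ) * p - 2 * Polynomial.X * Polynomial.derivative p := rfl

lemma eulerOp_mul (i j : ℕ) (a b : Polynomial ℝ) :
    eulerOp (i + j) (a * b) = eulerOp i a * b + a * eulerOp j b := by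
  simp only [eulerOp_apply, Polynomial.derivative_mul]
  push_cast
  ring

lemma treesOf_add_two (n : ℕ) : treesOf (n + 2) =
    (Finset.range (n + 1)).biUnion fun k =>
      ((treesOf (k + 1)) ×ˢ (treesOf (n + 1 - k))).image fun p => BinTree.node p.1 p.2 := by
  rw [treesOf]
  ext τ
  simp only [Finset.mem_biUnion, Finset.mem_attach, true_and, Subtype.exists, exists_prop]

lemma magnitude_of_mem_treesOf {n : ℕ} {τ : BinTree} (h : τ ∈ treesOf n) : τ.magnitude = n := by
  induction τ generalizing n with
  | leaf =>
    match n with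
    | 0 => simp [treesOf] at h
    | 1 => rfl
    | n + 2 => simp [treesOf_add_two] at h
  | node a b iha ihb =>
    match n with
    | 0 => simp [treesOf] at h
    | 1 => simp [treesOf] at h
    | n + 2 =>
      simp only [treesOf_add_two, Finset.mem_biUnion, Finset.mem_image, Finset.mem_product,
        Finset.mem_range, Prod.exists, BinTree.node.injEq] at h
      obtain ⟨k, hk, x, y, ⟨hx, hy⟩, rfl, rfl⟩ := h
      rw [BinTree.magnitude, iha hx, ihb hy]
      omega

lemma sum_treesOf_add_two {M : Type*} [AddCommMonoid M] (n : ℕ) (f : BinTree → M) :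
    ∑ τ ∈ treesOf (n + 2), f τ = ∑ k ∈ Finset.range (n + 1),
      ∑ a ∈ treesOf (k + 1), ∑ b ∈ treesOf (n + 1 - k), f (BinTree.node a b) := by
  rw [treesOf_add_two, Finset.sum_biUnion]
  · refine Finset.sum_congr rfl fun k _ => ?_
    rw [Finset.sum_image, Finset.sum_product]
    rintro ⟨a, b⟩ _ ⟨c, d⟩ _ h
    simpa using h
  · intro i _ j _ hij
    rw [Function.onFun, Finset.disjoint_left]
    intro τ hi hj
    simp only [Finset.mem_image, Finset.mem_product, Prod.exists] at hi hj
    obtain ⟨a, b, ⟨ha, _⟩, rfl⟩ := hi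
    obtain ⟨c, d, ⟨hc, _⟩, h⟩ := hj
    obtain ⟨rfl, rfl⟩ := BinTree.node.inj h
    have := magnitude_of_mem_treesOf ha
    have := magnitude_of_mem_treesOf hc
    omega

lemma treesOf_nonempty {n : ℕ} (hn : n ≠ 0) : (treesOf n).Nonempty := by
  induction n using Nat.strong_induction_on with
  | _ n ih =>
    match n, hn with
    | 1, _ => exact ⟨.leaf, by simp [treesOf]⟩
    | n + 2, _ =>
      obtain ⟨b, hb⟩ := ih (n + 1) (by omega) (by omega)
      refine ⟨.node .leaf b, ?_⟩
      rw [treesOf_add_two]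
      simp only [Finset.mem_biUnion, Finset.mem_image, Finset.mem_product, Finset.mem_range,
        Prod.exists, BinTree.node.injEq]
      exact ⟨0, by omega, .leaf, b, ⟨by simp [treesOf], hb⟩, rfl, rfl⟩

lemma BinTree.one_le_ord (τ : BinTree) : 1 ≤ τ.ord := by
  induction τ with
  | leaf => simp [ord]
  | node a b iha ihb => rw [ord]; split_ifs <;> omega

lemma BinTree.ord_eq_one_iff (τ : BinTree) : τ.ord = 1 ↔ τ = leaf := by
  cases τ with
  | leaf => simp [ord]
  | node a b =>
    have := one_le_ord a
    have := one_le_ord b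
    simp only [ord, reduceCtorEq, iff_false]
    split_ifs <;> omega

lemma BinTree.branches_two_node (a b : BinTree) :
    (node a b).branches 2 = a.branches 2 + b.branches 2 + if a = leaf ∧ b = leaf then 1 else 0 := by
  rw [branches]
  congr 1
  refine if_congr ?_ rfl rfl
  rw [← ord_eq_one_iff, ← ord_eq_one_iff]
  omega

/-- The generating polynomial of `S_{2,n}` over the trees of magnitude `n`. -/
noncomputable def branchPoly (n : ℕ) : Polynomial ℝ :=
  ∑ τ ∈ treesOf n, Polynomial.monomial (τ.branches 2) 1

lemma branchPoly_zero : branchPoly 0 = 0 := by simp [branchPoly, treesOf]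

lemma branchPoly_one : branchPoly 1 = 1 := by simp [branchPoly, treesOf, BinTree.branches]

lemma branchPoly_two : branchPoly 2 = Polynomial.X := by
  rw [branchPoly, sum_treesOf_add_two]
  simp [treesOf, BinTree.branches, BinTree.ord, Polynomial.X]

lemma branchPoly_add_three (n : ℕ) : branchPoly (n + 3) =
    ∑ k ∈ Finset.range (n + 2), branchPoly (k + 1) * branchPoly (n + 2 - k) := by
  rw [branchPoly, sum_treesOf_add_two]
  refine Finset.sum_congr rfl fun k hk => ?_
  rw [branchPoly, branchPoly, Finset.sum_mul_sum]
  refine Finset.sum_congr rfl fun a ha => Finset.sum_congr rfl fun b hb => ?_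
  have := magnitude_of_mem_treesOf ha
  have := magnitude_of_mem_treesOf hb
  rw [BinTree.branches_two_node, if_neg, Polynomial.monomial_mul_monomial]
  · simp
  · rintro ⟨rfl, rfl⟩
    simp only [BinTree.magnitude] at *
    omega

/-- The bivariate generating function of magnitude and number of branches of order two. -/
noncomputable def branchSeries : PowerSeries (Polynomial ℝ) := PowerSeries.mk branchPoly

lemma branchSeries_eq : branchSeries = branchSeries * branchSeries + PowerSeries.X
    + PowerSeries.C (Polynomial.X - 1) * PowerSeries.X ^ 2 := by
  ext1 n
  have h0 : PowerSeries.coeff n (branchSeries * branchSeries)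
      = ∑ k ∈ Finset.range (n + 1), branchPoly k * branchPoly (n - k) := by
    rw [PowerSeries.coeff_mul, Finset.Nat.sum_antidiagonal_eq_sum_range_succ_mk]
    simp [branchSeries]
  simp only [map_add, h0, PowerSeries.coeff_C_mul, PowerSeries.coeff_X_pow, PowerSeries.coeff_X]
  rw [branchSeries, PowerSeries.coeff_mk]
  match n with
  | 0 => simp [branchPoly_zero]
  | 1 => simp [Finset.sum_range_succ, branchPoly_zero, branchPoly_one]
  | 2 => simp [Finset.sum_range_succ, branchPoly_zero, branchPoly_one, branchPoly_two]
  | n + 3 =>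
    rw [Finset.sum_range_succ', Finset.sum_range_succ, branchPoly_add_three]
    simp [branchPoly_zero]

/-- Coefficientwise `d/dy`. -/
noncomputable abbrev dY : PowerSeries (Polynomial ℝ) → PowerSeries (Polynomial ℝ) :=
  coeffwise fun n => (fun _ => (Polynomial.derivative (R := ℝ)).toAddMonoidHom : ℕ → _ →+ _) n

/-- The derivation `t d/dt - 2 y d/dy`. -/
noncomputable abbrev dE : PowerSeries (Polynomial ℝ) → PowerSeries (Polynomial ℝ) :=
  coeffwise fun n => eulerOp n

lemma dY_add (F G) : dY (F + G) = dY F + dY G := coeffwise_add _ F G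

lemma dE_add (F G) : dE (F + G) = dE F + dE G := coeffwise_add _ F G

lemma dY_mul (F G) : dY (F * G) = dY F * G + F * dY G :=
  coeffwise_mul _ (fun i j a b => by simp [Polynomial.derivative_mul]) F G

lemma dE_mul (F G) : dE (F * G) = dE F * G + F * dE G :=
  coeffwise_mul _ eulerOp_mul F G

lemma dY_X : dY PowerSeries.X = 0 := by
  ext1 n
  by_cases h : n = 1 <;> simp [coeffwise, PowerSeries.coeff_X, h]

lemma dE_X : dE PowerSeries.X = PowerSeries.X := by
  ext1 n
  by_cases h : n = 1 <;> simp [coeffwise, PowerSeries.coeff_X, h, eulerOp_apply]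

lemma dY_C (p : Polynomial ℝ) :
    dY (PowerSeries.C p) = PowerSeries.C (Polynomial.derivative p) := by
  ext1 n
  by_cases h : n = 0 <;> simp [coeffwise, PowerSeries.coeff_C, h]

lemma dE_C (p : Polynomial ℝ) :
    dE (PowerSeries.C p) = PowerSeries.C (-2 * Polynomial.X * Polynomial.derivative p) := by
  ext1 n
  by_cases h : n = 0 <;> simp [coeffwise, PowerSeries.coeff_C, h, eulerOp_apply]

lemma branchSeries_pde :
    4 * PowerSeries.C Polynomial.X * dY (dY branchSeries) - dE (dE branchSeries)
      + dE branchSeries = 0 := by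
  have h := branchSeries_eq
  set F := branchSeries
  set t : PowerSeries (Polynomial ℝ) := PowerSeries.X with ht
  have hYt : dY t = 0 := dY_X
  have hEt : dE t = t := dE_X
  set y : PowerSeries (Polynomial ℝ) := PowerSeries.C Polynomial.X with hy
  have hsub : PowerSeries.C ((Polynomial.X : Polynomial ℝ) - 1) = y + PowerSeries.C (-1) := by
    rw [hy, ← map_add, sub_eq_add_neg]
  rw [hsub] at h
  have hYy : dY y = 1 := by rw [hy, dY_C]; simp
  have hEy : dE y = -2 * y := by
    rw [hy, dE_C, Polynomial.derivative_X, mul_one, map_mul, map_neg, map_ofNat]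
  have hY1 : dY (PowerSeries.C (-1)) = 0 := by rw [dY_C]; simp
  have hE1 : dE (PowerSeries.C (-1)) = 0 := by rw [dE_C]; simp
  have hm1 : PowerSeries.C (-1 : Polynomial ℝ) = -1 := by simp
  have hY : dY F = dY F * F + F * dY F + t * t := by
    conv_lhs => rw [h]
    simp only [pow_two, dY_add, dY_mul, hYt, hYy, hY1]
    ring
  have hE : dE F = dE F * F + F * dE F + t + (2 * PowerSeries.C (-1)) * (t * t) := by
    conv_lhs => rw [h]
    simp only [pow_two, dE_add, dE_mul, hEt, hEy, hE1]
    ring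
  have h2 : (2 : PowerSeries (Polynomial ℝ)) = PowerSeries.C 2 := (map_ofNat PowerSeries.C 2).symm
  have hE2 : dE 2 = 0 := by rw [h2, dE_C]; simp
  have hYY : dY (dY F) = dY (dY F) * F + 2 * (dY F * dY F) + F * dY (dY F) := by
    conv_lhs => rw [hY]
    simp only [dY_add, dY_mul, hYt]
    ring
  have hEE : dE (dE F) = dE (dE F) * F + 2 * (dE F * dE F) + F * dE (dE F) + t - 4 * (t * t) := by
    conv_lhs => rw [hE]
    simp only [dE_add, dE_mul, hEt, hE1, hE2]
    rw [hm1]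
    ring
  rw [hm1] at h hE
  have hG : (1 - 2 * F) ^ 3 ≠ 0 := by
    refine pow_ne_zero _ fun h0 => ?_
    have h1 := congrArg PowerSeries.constantCoeff h0
    have h2 : PowerSeries.constantCoeff F = 0 := by
      simp [F, branchSeries, branchPoly_zero]
    simp [h2] at h1
  refine (mul_eq_zero.mp ?_).resolve_left hG
  generalize dY (dY F) = FYY at *
  generalize dE (dE F) = FEE at *
  generalize dE F = FE at *
  generalize dY F = FY at *
  clear_value F t y
  have a1 : (1 - 2 * F) * FY = t ^ 2 := by linear_combination hY
  have a2 : (1 - 2 * F) * FE = t - 2 * t ^ 2 := by linear_combination hE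
  have a3 : (1 - 2 * F) * FYY = 2 * FY ^ 2 := by linear_combination hYY
  have a4 : (1 - 2 * F) * FEE = 2 * FE ^ 2 + t - 4 * t ^ 2 := by linear_combination hEE
  have a5 : (1 - 2 * F) ^ 2 = (1 - 2 * t) ^ 2 - 4 * y * t ^ 2 := by linear_combination -4 * h
  generalize 1 - 2 * F = G at *
  have b1 : G ^ 3 * FYY = 2 * t ^ 4 := by
    linear_combination G ^ 2 * a3 + 2 * (G * FY + t ^ 2) * a1
  have b2 : G ^ 3 * FEE = 2 * (t - 2 * t ^ 2) ^ 2 + G ^ 2 * (t - 4 * t ^ 2) := by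
    linear_combination G ^ 2 * a4 + 2 * (G * FE + (t - 2 * t ^ 2)) * a2
  linear_combination 4 * y * b1 - b2 + G ^ 2 * a2 + 2 * t ^ 2 * a5

lemma branchPoly_ode (n : ℕ) :
    4 * Polynomial.X * Polynomial.derivative (Polynomial.derivative (branchPoly n))
      - eulerOp n (eulerOp n (branchPoly n)) + eulerOp n (branchPoly n) = 0 := by
  have h := congrArg (PowerSeries.coeff n) branchSeries_pde
  have h4 : (4 : PowerSeries (Polynomial ℝ)) = PowerSeries.C 4 := (map_ofNat PowerSeries.C 4).symm
  rw [h4, ← map_mul] at h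
  simp only [map_add, map_sub, PowerSeries.coeff_C_mul, map_zero] at h
  simpa [coeffwise, branchSeries] using h

/-- Stein-type identity for the number of branches of order two. -/
lemma sum_branches_stein (n : ℕ) (g : ℝ → ℝ) :
    ∑ τ ∈ treesOf n, 4 * (τ.branches 2 : ℝ) * ((τ.branches 2 : ℝ) - 1) * g (τ.branches 2)
      = ∑ τ ∈ treesOf n, ((n : ℝ) - 2 * τ.branches 2) * ((n : ℝ) - 2 * τ.branches 2 - 1)
          * g (τ.branches 2 + 1) := by
  have key (m : ℕ) : 4 * Polynomial.X
        * Polynomial.derivative (Polynomial.derivative (Polynomial.monomial m (1 : ℝ)))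
      - eulerOp n (eulerOp n (Polynomial.monomial m 1)) + eulerOp n (Polynomial.monomial m 1)
      = (4 * (m : ℝ) * (m - 1)) • Polynomial.monomial (m - 1) (1 : ℝ)
        - (((n : ℝ) - 2 * m) * (n - 2 * m - 1)) • Polynomial.monomial m (1 : ℝ) := by
    have e1 (p : Polynomial ℝ) (hp : Polynomial.X * Polynomial.derivative p = (m : ℝ) • p) :
        eulerOp n p = ((n : ℝ) - 2 * m) • p := by
      rw [eulerOp_apply, mul_assoc, hp]
      simp only [Polynomial.smul_eq_C_mul, map_sub, map_mul, map_ofNat, map_natCast]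
      ring
    have e2 : Polynomial.X * Polynomial.derivative (Polynomial.monomial m (1 : ℝ))
        = (m : ℝ) • Polynomial.monomial m (1 : ℝ) := by
      rcases m with _ | m
      · simp
      · rw [Polynomial.derivative_monomial, Polynomial.X_mul_monomial, Polynomial.smul_monomial]
        simp
    rw [e1 _ e2, e1 _ (by rw [Polynomial.derivative_smul, mul_smul_comm, e2, smul_comm])]
    have e3 : 4 * Polynomial.X
        * Polynomial.derivative (Polynomial.derivative (Polynomial.monomial m (1 : ℝ)))
        = (4 * (m : ℝ) * (m - 1)) • Polynomial.monomial (m - 1) (1 : ℝ) := by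
      have h4 : (4 : Polynomial ℝ) = Polynomial.C 4 := (map_ofNat Polynomial.C 4).symm
      rcases m with _ | _ | m
      · simp
      · simp
      · rw [Polynomial.derivative_monomial, Polynomial.derivative_monomial, mul_assoc,
          Polynomial.X_mul_monomial, Polynomial.smul_monomial, h4, Polynomial.C_mul_monomial]
        push_cast
        simp only [add_tsub_cancel_right]
        congr 1
        simp
        ring
    rw [e3, smul_smul, sub_add, ← sub_smul]
    congr 2
    ring
  set L := (Polynomial.basisMonomials ℝ).constr ℝ fun m : ℕ => g (m + 1) with hL
  have hLm (m : ℕ) : L (Polynomial.monomial m 1) = g (m + 1) := by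
    have := (Polynomial.basisMonomials ℝ).constr_basis ℝ (fun m : ℕ => g (m + 1)) m
    simpa [Polynomial.coe_basisMonomials] using this
  have h := congrArg L (branchPoly_ode n)
  rw [branchPoly] at h
  simp only [map_sum, Finset.mul_sum, ← Finset.sum_sub_distrib, ← Finset.sum_add_distrib, key,
    map_sub, map_smul, hLm, smul_eq_mul, map_zero] at h
  rw [← sub_eq_zero, ← Finset.sum_sub_distrib, ← h]
  refine Finset.sum_congr rfl fun τ _ => ?_
  congr 1
  rcases τ.branches 2 with _ | m <;> simp

lemma expect_add (n : ℕ) (f g : BinTree → ℝ) :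
    expect n (fun τ => f τ + g τ) = expect n f + expect n g := by
  simp only [expect, Finset.sum_add_distrib, add_div]

lemma expect_const_mul (n : ℕ) (c : ℝ) (f : BinTree → ℝ) :
    expect n (fun τ => c * f τ) = c * expect n f := by
  simp only [expect, ← Finset.mul_sum, mul_div_assoc]

lemma expect_sum {ι : Type*} (n : ℕ) (s : Finset ι) (f : ι → BinTree → ℝ) :
    expect n (fun τ => ∑ i ∈ s, f i τ) = ∑ i ∈ s, expect n (f i) := by
  simp only [expect, ← Finset.sum_div]
  rw [Finset.sum_comm]

lemma expect_one {n : ℕ} (hn : n ≠ 0) : expect n (fun _ => 1) = 1 := by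
  have : ((treesOf n).card : ℝ) ≠ 0 := by exact_mod_cast (treesOf_nonempty hn).card_pos.ne'
  simp [expect, this]

/-- The `r`-th moment of `S_{2,n}` centred at `n / 4`. -/
noncomputable def centredMoment (r n : ℕ) : ℝ :=
  expect n fun τ => ((τ.branches 2 : ℝ) - (n : ℝ) / 4) ^ r

lemma centredMoment_recurrence (r n : ℕ) :
    (4 * (n : ℝ) - 6) * centredMoment (r + 1) n = (n : ℝ) / 2 * centredMoment r n
      + ∑ j ∈ Finset.range r, (r.choose j : ℝ) * (((n : ℝ) ^ 2 / 4 - n / 2) * centredMoment j n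
        + (2 - 2 * (n : ℝ)) * centredMoment (j + 1) n + 4 * centredMoment (j + 2) n) := by
  have h := sum_branches_stein n fun x => (x - (n : ℝ) / 4) ^ r
  simp only [centredMoment, ← expect_const_mul, ← expect_add, ← expect_sum]
  simp only [expect]
  congr 1
  rw [← sub_eq_zero, ← Finset.sum_sub_distrib] at h ⊢
  rw [← h]
  refine Finset.sum_congr rfl fun τ _ => ?_
  set S : ℝ := (τ.branches 2 : ℝ)
  have hb : (S + 1 - (n : ℝ) / 4) ^ r = (S - (n : ℝ) / 4) ^ r
      + ∑ j ∈ Finset.range r, (r.choose j : ℝ) * (S - (n : ℝ) / 4) ^ j := by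
    rw [show S + 1 - (n : ℝ) / 4 = (S - (n : ℝ) / 4) + 1 by ring, add_pow, Finset.sum_range_succ]
    simp only [one_pow, mul_one, Nat.choose_self, Nat.cast_one]
    rw [add_comm]
    congr 1
    exact Finset.sum_congr rfl fun j _ => mul_comm _ _
  have hs : ∑ j ∈ Finset.range r, (r.choose j : ℝ) * (((n : ℝ) ^ 2 / 4 - n / 2)
        * (S - (n : ℝ) / 4) ^ j + (2 - 2 * (n : ℝ)) * (S - (n : ℝ) / 4) ^ (j + 1)
        + 4 * (S - (n : ℝ) / 4) ^ (j + 2))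
      = ((n : ℝ) - 2 * S) * (n - 2 * S - 1)
        * ∑ j ∈ Finset.range r, (r.choose j : ℝ) * (S - (n : ℝ) / 4) ^ j := by
    rw [Finset.mul_sum]
    refine Finset.sum_congr rfl fun j _ => ?_
    ring
  rw [hs, hb]
  ring

/-- The moments of the centred Gaussian law of variance `1 / 16`. -/
noncomputable def limitMoment : ℕ → ℝ
  | 0 => 1
  | 1 => 0
  | r + 2 => ((r : ℝ) + 1) / 16 * limitMoment r

lemma limitMoment_even (s : ℕ) :
    limitMoment (2 * s) = (Nat.doubleFactorial (2 * s - 1) : ℝ) / 4 ^ (2 * s) := by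
  induction s with
  | zero => simp [limitMoment]
  | succ s ih =>
    rw [show 2 * (s + 1) = 2 * s + 2 by ring, limitMoment, ih]
    have : Nat.doubleFactorial (2 * s + 2 - 1) = (2 * s + 1) * Nat.doubleFactorial (2 * s - 1) := by
      rcases s with _ | s
      · simp
      · exact Nat.doubleFactorial_add_two (2 * s + 1)
    rw [this]
    push_cast
    ring

/-- The scale `n ^ (-1/2)`. -/
noncomputable def invSqrt (n : ℕ) : ℝ := (√(n : ℝ))⁻¹

lemma tendsto_invSqrt : Tendsto invSqrt atTop (𝓝 0) :=
  tendsto_inv_atTop_zero.comp (Real.tendsto_sqrt_atTop.comp tendsto_natCast_atTop_atTop)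

lemma invSqrt_pos {n : ℕ} (hn : n ≠ 0) : 0 < invSqrt n := by
  unfold invSqrt
  positivity

lemma invSqrt_sq (n : ℕ) : invSqrt n ^ 2 = (n : ℝ)⁻¹ := by
  rw [invSqrt, inv_pow, Real.sq_sqrt (Nat.cast_nonneg n)]

lemma cast_eq_invSqrt (n : ℕ) : (n : ℝ) = (invSqrt n ^ 2)⁻¹ := by
  rw [invSqrt_sq, inv_inv]

/-- The centred moment normalized by the scale of the fluctuations. -/
noncomputable def scaledMoment (r n : ℕ) : ℝ := invSqrt n ^ r * centredMoment r n

lemma scaledMoment_recurrence (r : ℕ) {n : ℕ} (hn : n ≠ 0) :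
    (4 - 6 * invSqrt n ^ 2) * scaledMoment (r + 1) n = invSqrt n / 2 * scaledMoment r n
      + ∑ j ∈ Finset.range r, (r.choose j : ℝ) *
        ((1 / 4 - invSqrt n ^ 2 / 2) * invSqrt n ^ (r - 1 - j) * scaledMoment j n
          + (2 * invSqrt n ^ 2 - 2) * invSqrt n ^ (r - j) * scaledMoment (j + 1) n
          + 4 * invSqrt n ^ (r + 1 - j) * scaledMoment (j + 2) n) := by
  have h := centredMoment_recurrence r n
  have hu := (invSqrt_pos hn).ne'
  rw [cast_eq_invSqrt n] at h
  simp only [scaledMoment]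
  generalize invSqrt n = u at *
  have h' := congrArg (fun x => u ^ (r + 3) * x) h
  simp only [mul_add, Finset.mul_sum] at h' ⊢
  convert h' using 1
  · field_simp
    ring
  · congr 1
    · field_simp
      ring
    · refine Finset.sum_congr rfl fun j hj => ?_
      obtain ⟨k, rfl⟩ := Nat.exists_eq_add_of_lt (Finset.mem_range.mp hj)
      rw [show j + k + 1 - 1 - j = k by omega, show j + k + 1 - j = k + 1 by omega,
        show j + k + 1 + 1 - j = k + 2 by omega]
      field_simp
      ring

lemma tendsto_of_mul_eventuallyEq {m T : ℕ → ℝ} {c L : ℝ}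
    (h : ∀ᶠ n in atTop, (4 - c * invSqrt n ^ 2) * m n = T n) (hT : Tendsto T atTop (𝓝 (4 * L))) :
    Tendsto m atTop (𝓝 L) := by
  have hd : Tendsto (fun n => 4 - c * invSqrt n ^ 2) atTop (𝓝 4) := by
    simpa using (((tendsto_invSqrt.pow 2).const_mul c).const_sub 4)
  have h4 := hT.div hd (by norm_num)
  rw [mul_div_cancel_left₀ _ (by norm_num : (4 : ℝ) ≠ 0)] at h4
  refine h4.congr' ?_
  filter_upwards [h, hd.eventually_ne (by norm_num : (4 : ℝ) ≠ 0)] with n hn hn'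
  rw [Pi.div_apply, ← hn, mul_div_cancel_left₀ _ hn']

lemma tendsto_scaledMoment (r : ℕ) : Tendsto (scaledMoment r) atTop (𝓝 (limitMoment r)) := by
  have hu := tendsto_invSqrt
  have hpow (k : ℕ) (hk : k ≠ 0) : Tendsto (fun n => invSqrt n ^ k) atTop (𝓝 0) := by
    simpa [hk] using hu.pow k
  have h0 : Tendsto (scaledMoment 0) atTop (𝓝 1) := by
    refine tendsto_const_nhds.congr' ?_
    filter_upwards [eventually_ne_atTop 0] with n hn
    simp [scaledMoment, centredMoment, expect_one hn]
  induction r using Nat.strong_induction_on with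
  | _ r ih =>
    match r with
    | 0 => simpa only [limitMoment] using h0
    | 1 =>
      refine tendsto_of_mul_eventuallyEq (c := 6)
        (T := fun n => invSqrt n / 2 * scaledMoment 0 n) ?_ ?_
      · filter_upwards [eventually_ne_atTop 0] with n hn
        simpa using scaledMoment_recurrence 0 hn
      · simpa [limitMoment] using (hu.div_const 2).mul h0
    | q + 2 =>
      have ih' {j : ℕ} (hj : j < q + 2) := ih j hj
      have hc1 : Tendsto (fun n => 1 / 4 - invSqrt n ^ 2 / 2) atTop (𝓝 (1 / 4)) := by
        simpa only [zero_div, sub_zero] using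
          ((hpow 2 two_ne_zero).div_const 2).const_sub (1 / 4)
      have hc2 : Tendsto (fun n => 2 * invSqrt n ^ 2 - 2) atTop (𝓝 (-2)) := by
        simpa using ((hpow 2 two_ne_zero).const_mul 2).sub_const 2
      refine tendsto_of_mul_eventuallyEq (c := 6 + 4 * ((q : ℝ) + 1))
        (T := fun n => invSqrt n / 2 * scaledMoment (q + 1) n
          + (∑ j ∈ Finset.range q, ((q + 1).choose j : ℝ) *
            ((1 / 4 - invSqrt n ^ 2 / 2) * invSqrt n ^ (q - j) * scaledMoment j n
              + (2 * invSqrt n ^ 2 - 2) * invSqrt n ^ (q + 1 - j) * scaledMoment (j + 1) n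
              + 4 * invSqrt n ^ (q + 2 - j) * scaledMoment (j + 2) n)
          + ((q : ℝ) + 1) * ((1 / 4 - invSqrt n ^ 2 / 2) * scaledMoment q n
              + (2 * invSqrt n ^ 2 - 2) * invSqrt n * scaledMoment (q + 1) n))) ?_ ?_
      · filter_upwards [eventually_ne_atTop 0] with n hn
        have h := scaledMoment_recurrence (q + 1) hn
        rw [Finset.sum_range_succ] at h
        simp only [Nat.choose_succ_self_right, add_tsub_cancel_right, tsub_self, pow_zero,
          Nat.add_sub_cancel_left, pow_one, show q + 1 + 1 - q = 2 by omega] at h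
        push_cast at h
        linear_combination h
      · have hsum : Tendsto (fun n => ∑ j ∈ Finset.range q, ((q + 1).choose j : ℝ) *
            ((1 / 4 - invSqrt n ^ 2 / 2) * invSqrt n ^ (q - j) * scaledMoment j n
              + (2 * invSqrt n ^ 2 - 2) * invSqrt n ^ (q + 1 - j) * scaledMoment (j + 1) n
              + 4 * invSqrt n ^ (q + 2 - j) * scaledMoment (j + 2) n)) atTop
            (𝓝 (∑ j ∈ Finset.range q, (0 : ℝ))) := by
          refine tendsto_finsetSum _ fun j hj => ?_
          have hj := Finset.mem_range.mp hj
          have t1 := (hc1.mul (hpow (q - j) (by omega))).mul (ih' (j := j) (by omega))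
          have t2 := (hc2.mul (hpow (q + 1 - j) (by omega))).mul (ih' (j := j + 1) (by omega))
          have t3 := ((hpow (q + 2 - j) (by omega)).const_mul 4).mul (ih' (j := j + 2) (by omega))
          simpa using ((t1.add t2).add t3).const_mul ((q + 1).choose j : ℝ)
        have a1 := (hu.div_const 2).mul (ih' (j := q + 1) (by omega))
        have a2 := hc1.mul (ih' (j := q) (by omega))
        have a3 := (hc2.mul hu).mul (ih' (j := q + 1) (by omega))
        convert a1.add (hsum.add ((a2.add a3).const_mul ((q : ℝ) + 1))) using 2
        simp only [limitMoment, Finset.sum_const_zero]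
        ring

lemma tendsto_scaled_mixedMoment (l r : ℕ) :
    Tendsto (fun n : ℕ => 4 ^ l * invSqrt n ^ (2 * l + r) * expect n fun τ =>
      (τ.branches 2 : ℝ) ^ l * ((τ.branches 2 : ℝ) - (n : ℝ) / 4) ^ r)
      atTop (𝓝 (limitMoment r)) := by
  induction l generalizing r with
  | zero =>
    refine (tendsto_scaledMoment r).congr fun n => ?_
    simp [scaledMoment, centredMoment]
  | succ l ih =>
    have h := ((tendsto_invSqrt.const_mul 4).mul (ih (r + 1))).add (ih r)
    rw [mul_zero, zero_mul, zero_add] at h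
    refine h.congr' ?_
    filter_upwards [eventually_ne_atTop 0] with n hn
    have e : (expect n fun τ =>
        (τ.branches 2 : ℝ) ^ (l + 1) * ((τ.branches 2 : ℝ) - (n : ℝ) / 4) ^ r)
        = (expect n fun τ =>
            (τ.branches 2 : ℝ) ^ l * ((τ.branches 2 : ℝ) - (n : ℝ) / 4) ^ (r + 1))
          + (n : ℝ) / 4 * expect n fun τ =>
            (τ.branches 2 : ℝ) ^ l * ((τ.branches 2 : ℝ) - (n : ℝ) / 4) ^ r := by
      rw [← expect_const_mul, ← expect_add]
      congr 1
      ext τ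
      ring
    have hn' : invSqrt n ^ 2 * n = 1 := by
      rw [invSqrt_sq, inv_mul_cancel₀ (Nat.cast_ne_zero.mpr hn)]
    rw [e]
    generalize (expect n fun τ =>
      (τ.branches 2 : ℝ) ^ l * ((τ.branches 2 : ℝ) - (n : ℝ) / 4) ^ r) = E
    linear_combination (-(4 ^ l * invSqrt n ^ (2 * l + r) * E)) * hn'

/-- Mixed even moments (Lemma 4, even case): for fixed `s, l ≥ 0`,
`⟨S_{2,n}^l (S_{2,n} − n/4)^{2s}⟩ ∼ (n/4)^l ((2s−1)!!/4^{2s}) n^s`. -/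
theorem mixed_even_moments_S2 (s l : ℕ) :
    Tendsto (fun n : ℕ =>
        expect n (fun τ =>
            (BinTree.branches 2 τ : ℝ) ^ l * ((BinTree.branches 2 τ : ℝ) - (n : ℝ) / 4) ^ (2*s))
          / (((n : ℝ) / 4) ^ l * ((Nat.doubleFactorial (2*s - 1) : ℝ) / 4 ^ (2*s)) * (n : ℝ) ^ s))
      atTop (𝓝 1) := by
  have hL : limitMoment (2 * s) ≠ 0 := by
    rw [limitMoment_even]
    have := Nat.doubleFactorial_pos (2 * s - 1)
    positivity
  have h := (tendsto_scaled_mixedMoment l (2 * s)).div_const (limitMoment (2 * s))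
  rw [div_self hL] at h
  refine h.congr' ?_
  filter_upwards [eventually_ne_atTop 0] with n hn
  rw [← limitMoment_even]
  have hn' : (n : ℝ) ≠ 0 := Nat.cast_ne_zero.mpr hn
  rw [← mul_add, pow_mul (invSqrt n), invSqrt_sq]
  generalize (expect n fun τ =>
    (τ.branches 2 : ℝ) ^ l * ((τ.branches 2 : ℝ) - (n : ℝ) / 4) ^ (2 * s)) = E
  rw [pow_add, inv_pow, inv_pow, div_pow]
  field_simp
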